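/- If a stack-based DFS procedure on an undirected connected graph maintains invariants (I1) the stack contents always form an ancestor-descendant path from the root in the constructed tree, and (I2) whenever a vertex is popped all its neighbors have been visited, then the tree produced upon termination is a spanning tree in which every non-tree edge is a back edge, i.e., a valid DFS tree. -/

import Mathlib

/-- `u` is an ancestor of `v` with respect to the parent function `par`
(every vertex is an ancestor of itself). -/
def IsAncestor {V : Type*} (par : V → V) (u v : V) : Prop := ∃ n : ℕ, par^[n] v = u

/-- A spanning tree of `G` rooted at `r`, given by a parent function:
the root is its own parent, every vertex reaches the root by iterating
the parent function, and each non-root vertex is adjacent to its parent. -/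
structure RootedSpanningTree {V : Type*} (G : SimpleGraph V) (r : V) where
  par : V → V
  par_root : par r = r
  reaches_root : ∀ v, ∃ n : ℕ, par^[n] v = r
  adj_par : ∀ v, v ≠ r → G.Adj (par v) v

/-- Every edge of `G` joins two vertices in ancestor-descendant relation
in the tree, i.e. there are no cross edges (all non-tree edges are back edges). -/
def RootedSpanningTree.noCrossEdges {V : Type*} {G : SimpleGraph V} {r : V}
    (T : RootedSpanningTree G r) : Prop :=
  ∀ u v, G.Adj u v → IsAncestor T.par u v ∨ IsAncestor T.par v u

/-- `v` lies on the ancestor-descendant tree path from `x` down to `y`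
(where `x` is an ancestor of `y`). -/
def OnTreePath {V : Type*} (par : V → V) (x y v : V) : Prop :=
  IsAncestor par x v ∧ IsAncestor par v y

/-- A configuration of the stack-based DFS procedure. -/
structure DFSState (V : Type*) where
  stack : List V
  visited : Finset V
  par : V → V

/-- One step of depth-first search: either push an unvisited neighbor of the
top of the stack (making it a child of the top), or pop the top of the stack. -/
inductive DFSStep {V : Type*} [DecidableEq V] (G : SimpleGraph V) :
    DFSState V → DFSState V → Prop
  | push (s : DFSState V) (w u : V) (hw : s.stack.head? = some w)
      (hadj : G.Adj w u) (hu : u ∉ s.visited) :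
      DFSStep G s ⟨u :: s.stack, insert u s.visited, Function.update s.par u w⟩
  | pop (s : DFSState V) (w : V) (rest : List V) (hs : s.stack = w :: rest) :
      DFSStep G s ⟨rest, s.visited, s.par⟩

/-- Reachability between DFS configurations. -/
def DFSReaches {V : Type*} [DecidableEq V] (G : SimpleGraph V) :
    DFSState V → DFSState V → Prop :=
  Relation.ReflTransGen (DFSStep G)

/-- The initial configuration of a DFS from root `r`. -/
def initState {V : Type*} (r : V) : DFSState V := ⟨[r], {r}, id⟩

/-- `T` can be produced by some depth-first search of `G` starting at `r`. -/
def IsDFSTree {V : Type*} [Fintype V] [DecidableEq V] (G : SimpleGraph V) (r : V)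
    (T : RootedSpanningTree G r) : Prop :=
  ∃ s : DFSState V, DFSReaches G (initState r) s ∧ s.stack = [] ∧
    s.visited = Finset.univ ∧ s.par = T.par

/-- The invariant maintained along the run. -/
structure RunInv {V : Type*} (G : SimpleGraph V) (r : V) (t : DFSState V) : Prop where
  root_mem : r ∈ t.visited
  stack_sub : ∀ v ∈ t.stack, v ∈ t.visited
  par_root : t.par r = r
  par_mem : ∀ v ∈ t.visited, t.par v ∈ t.visited
  par_adj : ∀ v ∈ t.visited, v ≠ r → G.Adj (t.par v) v
  reach : ∀ v ∈ t.visited, ∃ n : ℕ, t.par^[n] v = r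
  closed : ∀ v ∈ t.visited, v ∉ t.stack → ∀ y, G.Adj v y → y ∈ t.visited
  anc : ∀ u ∈ t.visited, ∀ v ∈ t.visited, G.Adj u v →
    IsAncestor t.par u v ∨ IsAncestor t.par v u

theorem iterate_update_eq {V : Type*} [DecidableEq V] (par : V → V) (S : Finset V)
    (hS : ∀ v ∈ S, par v ∈ S) (u w : V) (hu : u ∉ S) (n : ℕ) :
    ∀ v ∈ S, (Function.update par u w)^[n] v = par^[n] v := by
  induction n with
  | zero => intro v _; rfl
  | succ n ih =>
    intro v hv
    have hne : v ≠ u := fun h => hu (h ▸ hv)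
    rw [Function.iterate_succ_apply, Function.iterate_succ_apply,
      Function.update_of_ne hne, ih _ (hS v hv)]

theorem chain_ancestor {V : Type*} (par : V → V) (l : List V) :
    ∀ w, List.IsChain (fun a b => par a = b) (w :: l) →
      ∀ v ∈ w :: l, IsAncestor par v w := by
  induction l with
  | nil =>
    intro w _ v hv
    rw [List.mem_singleton] at hv
    exact ⟨0, hv.symm⟩
  | cons a l ih =>
    intro w h v hv
    rw [List.isChain_cons_cons] at h
    rcases List.mem_cons.1 hv with hv | hv
    · exact ⟨0, hv.symm⟩
    · obtain ⟨n, hn⟩ := ih a h.2 v hv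
      exact ⟨n + 1, by rw [Function.iterate_succ_apply, h.1, hn]⟩

theorem RunInv.init {V : Type*} (G : SimpleGraph V) (r : V) : RunInv G r (initState r) := by
  constructor <;> simp [initState]

theorem RunInv.push {V : Type*} [DecidableEq V] {G : SimpleGraph V} {r : V} {t : DFSState V}
    (h : RunInv G r t) (hc : List.IsChain (fun a b => t.par a = b) t.stack)
    (w u : V) (hw : t.stack.head? = some w) (hadj : G.Adj w u) (hu : u ∉ t.visited) :
    RunInv G r ⟨u :: t.stack, insert u t.visited, Function.update t.par u w⟩ := by
  have hne : ∀ v ∈ t.visited, v ≠ u := fun v hv e => hu (e ▸ hv)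
  have hit := iterate_update_eq t.par t.visited h.par_mem u w hu
  obtain ⟨l, hl⟩ : ∃ l, t.stack = w :: l := by
    cases hst : t.stack with
    | nil => simp [hst] at hw
    | cons a l => simp [hst] at hw; exact ⟨l, by rw [hw]⟩
  have hwv : w ∈ t.visited := h.stack_sub w (by simp [hl])
  have hup : ∀ {a b}, b ∈ t.visited → IsAncestor t.par a b →
      IsAncestor (Function.update t.par u w) a b := by
    rintro a b hb ⟨n, hn⟩
    exact ⟨n, by rw [hit n b hb, hn]⟩
  have hstep : ∀ {a}, IsAncestor t.par a w → IsAncestor (Function.update t.par u w) a u := by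
    rintro a ⟨n, hn⟩
    exact ⟨n + 1, by rw [Function.iterate_succ_apply, Function.update_self, hit n w hwv, hn]⟩
  have hnb : ∀ v ∈ t.visited, G.Adj u v → IsAncestor (Function.update t.par u w) v u := by
    intro v hv ha
    have hvs : v ∈ t.stack := by
      by_contra hn
      exact hu (h.closed v hv hn u ha.symm)
    rw [hl] at hvs hc
    exact hstep (chain_ancestor t.par l w hc v hvs)
  constructor
  · exact Finset.mem_insert_of_mem h.root_mem
  · intro v hv
    rcases List.mem_cons.1 hv with hv | hv
    · exact Finset.mem_insert.2 (Or.inl hv)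
    · exact Finset.mem_insert_of_mem (h.stack_sub v hv)
  · exact (Function.update_of_ne (hne r h.root_mem) _ _).trans h.par_root
  · intro v hv
    rcases Finset.mem_insert.1 hv with rfl | hv
    · simpa using Or.inr hwv
    · simpa [Function.update_of_ne (hne v hv)] using Or.inr (h.par_mem v hv)
  · intro v hv hvr
    rcases Finset.mem_insert.1 hv with rfl | hv
    · simpa using hadj
    · simpa [Function.update_of_ne (hne v hv)] using h.par_adj v hv hvr
  · intro v hv
    rcases Finset.mem_insert.1 hv with rfl | hv
    · exact hstep (h.reach w hwv)
    · exact hup hv (h.reach v hv)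
  · intro v hv hvs y hy
    have h1 : v ≠ u ∧ v ∉ t.stack := by simpa using hvs
    have hv' : v ∈ t.visited := Finset.mem_of_mem_insert_of_ne hv h1.1
    exact Finset.mem_insert_of_mem (h.closed v hv' h1.2 y hy)
  · intro a ha b hb hab
    rcases Finset.mem_insert.1 ha with rfl | ha'
    · rcases Finset.mem_insert.1 hb with rfl | hb
      · exact Or.inl ⟨0, rfl⟩
      · exact Or.inr (hnb b hb hab)
    · rcases Finset.mem_insert.1 hb with rfl | hb
      · exact Or.inl (hnb a ha' hab.symm)
      · exact (h.anc a ha' b hb hab).imp (hup hb) (hup ha')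

theorem RunInv.pop {V : Type*} {G : SimpleGraph V} {r : V} {t : DFSState V}
    (h : RunInv G r t) (w : V) (rest : List V) (hs : t.stack = w :: rest)
    (hn : ∀ y, G.Adj w y → y ∈ t.visited) :
    RunInv G r ⟨rest, t.visited, t.par⟩ where
  root_mem := h.root_mem
  stack_sub := fun v hv => h.stack_sub v (by rw [hs]; exact List.mem_cons_of_mem _ hv)
  par_root := h.par_root
  par_mem := h.par_mem
  par_adj := h.par_adj
  reach := h.reach
  closed := by
    intro v hv hvs y hy
    by_cases e : v = w
    · exact hn y (e ▸ hy)
    · exact h.closed v hv (by rw [hs]; simpa [e] using hvs) y hy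
  anc := h.anc

/-- If a stack-based DFS run on a connected graph `G`, starting from the root
`r` and terminating with an empty stack at configuration `s`, maintains the
invariants (I1) the stack contents of every intermediate configuration form
an ancestor-descendant path from the root in the constructed tree, and
(I2) whenever a vertex is popped all its neighbors have already been visited,
then the tree produced upon termination is a spanning tree of `G` in which
every non-tree edge is a back edge, i.e. a valid DFS tree. -/
theorem invariants_give_dfs_tree {V : Type*} [Fintype V] [DecidableEq V]
    (G : SimpleGraph V) (hG : G.Connected) (r : V)
    (s : DFSState V) (hrun : DFSReaches G (initState r) s)
    (hfin : s.stack = [])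
    (hI1 : ∀ t : DFSState V,
      DFSReaches G (initState r) t → DFSReaches G t s →
      t.stack.Chain' (fun a b => t.par a = b) ∧
      ∀ a ∈ t.stack, ∃ n : ℕ, t.par^[n] a = r)
    (hI2 : ∀ t u : DFSState V,
      DFSReaches G (initState r) t → DFSStep G t u → DFSReaches G u s →
      ∀ w rest, t.stack = w :: rest → u.stack = rest → u.visited = t.visited →
        ∀ y, G.Adj w y → y ∈ t.visited) :
    s.visited = Finset.univ ∧
    ∃ T : RootedSpanningTree G r, T.par = s.par ∧ T.noCrossEdges := by
  have hinv : ∀ t, DFSReaches G (initState r) t → DFSReaches G t s → RunInv G r t := by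
    intro t ht
    induction ht with
    | refl => intro _; exact RunInv.init G r
    | @tail b c hb hbc ih =>
      intro hcs
      have hbs : DFSReaches G b s := Relation.ReflTransGen.head hbc hcs
      have hB := ih hbs
      have hc := (hI1 b hb hbs).1
      have h2 := hI2 b c hb hbc hcs
      cases hbc with
      | push w u hw hadj hu => exact hB.push hc w u hw hadj hu
      | pop w rest hs => exact hB.pop w rest hs (h2 w rest hs rfl rfl)
  have h := hinv s hrun Relation.ReflTransGen.refl
  have hall : ∀ v, v ∈ s.visited := by
    intro v
    obtain ⟨p⟩ := hG.preconnected r v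
    have key : ∀ {a b : V}, G.Walk a b → a ∈ s.visited → b ∈ s.visited := by
      intro a b p
      induction p with
      | nil => exact id
      | cons hab _ ih => exact fun ha => ih (h.closed _ ha (by simp [hfin]) _ hab)
    exact key p h.root_mem
  exact ⟨Finset.eq_univ_of_forall hall,
    ⟨s.par, h.par_root, fun v => h.reach v (hall v), fun v => h.par_adj v (hall v)⟩, rfl,
    fun u v huv => h.anc u (hall u) v (hall v) huv⟩
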